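/- Let P ⊆ ℝⁿ be a lattice n-polytope. If there exists an integer r with 1 ≤ r ≤ n−1 such that the topological interior of the dilate rP contains no point of ℤⁿ, then for every integer k ≥ n−r the equality (kP) ∩ ℤⁿ + P ∩ ℤⁿ = ((k+1)P) ∩ ℤⁿ holds, where + denotes Minkowski sum. -/

import Mathlib

open Set Pointwise

noncomputable section

/-- The set of lattice points of `ℝⁿ`: points with all coordinates integers. -/
def lat (n : ℕ) : Set (Fin n → ℝ) := {x | ∀ i, ∃ z : ℤ, x i = (z : ℝ)}

/-- The dilate `kP` of a subset `P ⊆ ℝⁿ`. -/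
def dilate (n k : ℕ) (P : Set (Fin n → ℝ)) : Set (Fin n → ℝ) :=
  (fun x => (k : ℝ) • x) '' P

/-- A lattice `n`-polytope: the convex hull of finitely many lattice points,
whose affine hull is all of `ℝⁿ`. -/
def IsLatticePolytope (n : ℕ) (P : Set (Fin n → ℝ)) : Prop :=
  (∃ S : Finset (Fin n → ℤ), S.Nonempty ∧
    P = convexHull ℝ ((fun m : Fin n → ℤ => fun i => (m i : ℝ)) '' (S : Set (Fin n → ℤ)))) ∧
  affineSpan ℝ P = ⊤

/-- The cone of `P` at a point `v`: `C_v(P) = {r • (x - v) : r ≥ 0, x ∈ P}`. -/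
def coneAt (n : ℕ) (P : Set (Fin n → ℝ)) (v : Fin n → ℝ) : Set (Fin n → ℝ) :=
  {y | ∃ r : ℝ, 0 ≤ r ∧ ∃ x ∈ P, y = r • (x - v)}

/-- `P` is Gorenstein at `v`: there is a lattice point `m₀` in `C_v(P)` with
`Int(C_v(P)) ∩ ℤⁿ = m₀ + (C_v(P) ∩ ℤⁿ)`. -/
def GorensteinAt (n : ℕ) (P : Set (Fin n → ℝ)) (v : Fin n → ℝ) : Prop :=
  ∃ m₀ ∈ coneAt n P v ∩ lat n,
    interior (coneAt n P v) ∩ lat n = (fun y => m₀ + y) '' (coneAt n P v ∩ lat n)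

/-- `P` is Gorenstein: it is Gorenstein at every vertex (extreme point). -/
def Gorenstein (n : ℕ) (P : Set (Fin n → ℝ)) : Prop :=
  ∀ v ∈ Set.extremePoints ℝ P, GorensteinAt n P v

/-- `F` is a facet of the `n`-polytope `P`: a face (extreme subset) of dimension `n-1`. -/
def IsFacet (n : ℕ) (P F : Set (Fin n → ℝ)) : Prop :=
  IsExtreme ℝ P F ∧ Module.finrank ℝ (affineSpan ℝ F).direction = n - 1

/-- `P` is a pyramid: there are a facet `F` and a vertex `v ∉ F` with `P = Conv(F ∪ {v})`. -/
def IsPyramid (n : ℕ) (P : Set (Fin n → ℝ)) : Prop :=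
  ∃ F v, IsFacet n P F ∧ v ∈ Set.extremePoints ℝ P ∧ v ∉ F ∧
    P = convexHull ℝ (F ∪ {v})

/-- The simplex `D_n = Conv{0, e₁, e₂, e₁+e₂+2e₃, e₄, …, eₙ}` (standard basis `e₁, …, eₙ`,
so `eᵢ = Pi.single i⁻¹` with 0-based indices; the points `Pi.single i 1` for `(i : ℕ) ≠ 2`
are `e₁, e₂, e₄, …, eₙ`, and the last listed point is `e₁ + e₂ + 2e₃`). -/
def Dn (n : ℕ) : Set (Fin n → ℝ) :=
  convexHull ℝ ({0} ∪ {x | ∃ i : Fin n, (i : ℕ) ≠ 2 ∧ x = Pi.single i (1 : ℝ)} ∪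
    {fun j : Fin n => if (j : ℕ) = 0 ∨ (j : ℕ) = 1 then (1 : ℝ) else
      if (j : ℕ) = 2 then 2 else 0})

/-- The affine map `x ↦ A·x + b` of `ℝⁿ` given by an integral matrix `A` and `b ∈ ℤⁿ`. -/
def unimodularMap (n : ℕ) (A : Matrix (Fin n) (Fin n) ℤ) (b : Fin n → ℤ) :
    (Fin n → ℝ) → (Fin n → ℝ) :=
  fun x => (A.map (Int.cast : ℤ → ℝ)).mulVec x + fun i => (b i : ℝ)

/-- The basic simplex `Conv{0, e₁, …, eₙ}`. -/
def basicSimplex (n : ℕ) : Set (Fin n → ℝ) :=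
  convexHull ℝ ({0} ∪ Set.range fun i : Fin n => (Pi.single i (1 : ℝ) : Fin n → ℝ))

/-- A ray (one-dimensional face) of a cone `C`. -/
def IsRay (n : ℕ) (C ρ : Set (Fin n → ℝ)) : Prop :=
  IsExtreme ℝ C ρ ∧ Module.finrank ℝ (Submodule.span ℝ ρ) = 1


/-- An affinely independent subset of `t` extends to an affinely independent subset of `t`
with the same affine span as `t`. -/
theorem exists_affineIndependent_extension {k V : Type*} [DivisionRing k] [AddCommGroup V]
    [Module k V] {s t : Set V} (hs : AffineIndependent k ((↑) : s → V)) (hne : s.Nonempty)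
    (hst : s ⊆ t) :
    ∃ b ⊆ t, s ⊆ b ∧ affineSpan k b = affineSpan k t ∧ AffineIndependent k ((↑) : b → V) := by
  obtain ⟨p, hp⟩ := hne
  rw [affineIndependent_set_iff_linearIndependent_vsub k hp] at hs
  have hsub : (fun x => x -ᵥ p) '' (s \ {p}) ⊆ (fun x => x -ᵥ p) '' t :=
    image_mono (sdiff_subset.trans hst)
  obtain ⟨b, hbt, hsb, hspan, hind⟩ := exists_linearIndepOn_id_extension hs hsub
  have hb₀ : ∀ v ∈ b, v ≠ 0 := fun v hv => hind.ne_zero hv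
  have hind' : LinearIndependent k ((↑) : b → V) := hind
  rw [linearIndependent_set_iff_affineIndependent_vadd_union_singleton k hb₀ p] at hind'
  have hut : {p} ∪ (fun v => v +ᵥ p) '' b ⊆ t := by
    rintro _ (rfl | ⟨v, hv, rfl⟩)
    · exact hst hp
    · obtain ⟨x, hx, rfl⟩ := hbt hv
      simpa using hx
  refine ⟨_, hut, ?_, ?_, hind'⟩
  · intro x hx
    by_cases hxp : x = p
    · exact Or.inl hxp
    · exact Or.inr ⟨x -ᵥ p, hsb ⟨x, ⟨hx, hxp⟩, rfl⟩, by simp⟩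
  · refine le_antisymm (affineSpan_mono k hut) (affineSpan_le.2 fun x hx => ?_)
    have hpu : p ∈ affineSpan k ({p} ∪ (fun v => v +ᵥ p) '' b) :=
      mem_affineSpan k (Or.inl rfl)
    have hle : Submodule.span k b ≤
        (affineSpan k ({p} ∪ (fun v => v +ᵥ p) '' b)).direction := by
      refine Submodule.span_le.2 fun v hv => ?_
      have hvp : v +ᵥ p ∈ affineSpan k ({p} ∪ (fun v => v +ᵥ p) '' b) :=
        mem_affineSpan k (Or.inr ⟨v, hv, rfl⟩)
      simpa only [vadd_vsub, SetLike.mem_coe] using AffineSubspace.vsub_mem_direction hvp hpu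
    simpa using AffineSubspace.vadd_mem_of_mem_direction (hle (hspan ⟨x, hx, rfl⟩)) hpu

/-- Carathéodory's theorem for a spanning set: the affinely independent set can be taken to be
an affine basis. -/
theorem exists_affineBasis_mem_convexHull {V : Type*} [AddCommGroup V] [Module ℝ V]
    {t : Set V} (ht : affineSpan ℝ t = ⊤) {x : V} (hx : x ∈ convexHull ℝ t) :
    ∃ (u : Set V) (b : AffineBasis u ℝ V), u ⊆ t ∧ ⇑b = ((↑) : u → V) ∧
      x ∈ convexHull ℝ (range b) := by
  rw [convexHull_eq_union] at hx
  simp only [mem_iUnion] at hx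
  obtain ⟨s, hst, hind, hxs⟩ := hx
  have hne : (s : Set V).Nonempty := convexHull_nonempty_iff.1 ⟨x, hxs⟩
  obtain ⟨u, hut, hsu, hspan, hu⟩ := exists_affineIndependent_extension hind hne hst
  refine ⟨u, ⟨(↑), hu, by rw [Subtype.range_coe, hspan, ht]⟩, hut, rfl, ?_⟩
  rw [← Subtype.range_coe (s := u)] at hsu
  exact convexHull_mono hsu hxs

/-- The lattice points form an additive subgroup. -/
def latSubgroup (n : ℕ) : AddSubgroup (Fin n → ℝ) where
  carrier := lat n
  zero_mem' i := ⟨0, by simp⟩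
  add_mem' {x y} hx hy i := by
    obtain ⟨a, ha⟩ := hx i
    obtain ⟨b, hb⟩ := hy i
    exact ⟨a + b, by simp [ha, hb]⟩
  neg_mem' {x} hx i := by
    obtain ⟨a, ha⟩ := hx i
    exact ⟨-a, by simp [ha]⟩

theorem dilate_eq_smul (n k : ℕ) (P : Set (Fin n → ℝ)) : dilate n k P = (k : ℝ) • P := rfl

/-- A point of the dilate of a convex set, as a nonnegative combination of points of the set. -/
theorem sum_smul_mem_dilate {n k : ℕ} (hk : 0 < k) {P : Set (Fin n → ℝ)} (hP : Convex ℝ P)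
    {ι : Type*} [Fintype ι] {w : ι → ℝ} {v : ι → Fin n → ℝ} (hw : ∀ i, 0 ≤ w i)
    (hsum : ∑ i, w i = k) (hv : ∀ i, v i ∈ P) : ∑ i, w i • v i ∈ dilate n k P := by
  have hk' : (0 : ℝ) < k := by exact_mod_cast hk
  refine ⟨∑ i, (w i / k) • v i, hP.sum_mem (fun i _ => div_nonneg (hw i) hk'.le) ?_
    (fun i _ => hv i), ?_⟩
  · rw [← Finset.sum_div, hsum, div_self hk'.ne']
  · simp only [Finset.smul_sum, smul_smul]
    exact Finset.sum_congr rfl fun i _ => by rw [mul_div_cancel₀ _ hk'.ne']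

/-- A positive combination of an affine basis lies in the interior of the dilated simplex. -/
theorem sum_smul_mem_interior_dilate {n k : ℕ} (hk : 0 < k) {ι : Type*} [Fintype ι]
    (b : AffineBasis ι ℝ (Fin n → ℝ)) {w : ι → ℝ} (hw : ∀ i, 0 < w i)
    (hsum : ∑ i, w i = k) :
    ∑ i, w i • b i ∈ interior (dilate n k (convexHull ℝ (range b))) := by
  have hk' : (0 : ℝ) < k := by exact_mod_cast hk
  rw [dilate_eq_smul, interior_smul₀ hk'.ne', b.interior_convexHull]
  have hsum' : ∑ i, w i / k = 1 := by rw [← Finset.sum_div, hsum, div_self hk'.ne']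
  refine ⟨∑ i, (w i / k) • b i, fun i => ?_, ?_⟩
  · rw [← Finset.affineCombination_eq_linear_combination _ _ _ hsum',
      b.coord_apply_combination_of_mem (Finset.mem_univ i) hsum']
    exact div_pos (hw i) hk'
  · simp only [Finset.smul_sum, smul_smul]
    exact Finset.sum_congr rfl fun i _ => by rw [mul_div_cancel₀ _ hk'.ne']

/-- If some dilate `rP` (`1 ≤ r ≤ n-1`) of a lattice `n`-polytope has no interior
lattice points, then `(kP ∩ ℤⁿ) + (P ∩ ℤⁿ) = (k+1)P ∩ ℤⁿ` for all `k ≥ n - r`. -/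
theorem lemma_no_interior_points_normal_range (n : ℕ) (P : Set (Fin n → ℝ))
    (hP : IsLatticePolytope n P)
    (r : ℕ) (hr1 : 1 ≤ r) (hr2 : r ≤ n - 1)
    (hempty : interior (dilate n r P) ∩ lat n = ∅) :
    ∀ k : ℕ, n - r ≤ k →
      (dilate n k P ∩ lat n) + (P ∩ lat n) = dilate n (k + 1) P ∩ lat n := by
  classical
  obtain ⟨⟨S, -, hS⟩, hspan⟩ := hP
  have hconv : Convex ℝ P := hS ▸ convex_convexHull ℝ _
  intro k hk
  have hk0 : 0 < k := by omega
  refine Subset.antisymm ?_ ?_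
  · rintro _ ⟨x, ⟨hx, hxl⟩, y, ⟨hy, hyl⟩, rfl⟩
    refine ⟨?_, (latSubgroup n).add_mem hxl hyl⟩
    rw [dilate_eq_smul, Nat.cast_add_one, hconv.add_smul k.cast_nonneg zero_le_one, one_smul]
    exact add_mem_add hx hy
  rintro x ⟨⟨p, hp, hpx⟩, hxl⟩
  have hx : ((k + 1 : ℕ) : ℝ) • p = x := hpx
  rw [hS, affineSpan_convexHull] at hspan
  rw [hS] at hp
  obtain ⟨u, b, hu, hb, hpb⟩ := exists_affineBasis_mem_convexHull hspan hp
  have hbP : ∀ i, b i ∈ P := fun i => by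
    rw [hS, hb]
    exact subset_convexHull ℝ _ (hu i.2)
  have hbl : ∀ i, b i ∈ latSubgroup n := fun i => by
    rw [hb]
    obtain ⟨m, -, hm⟩ := hu i.2
    exact fun j => ⟨m j, by rw [← hm]⟩
  have : Finite u := finite_of_fin_dim_affineIndependent ℝ b.ind
  have := Fintype.ofFinite u
  have hcard : (Fintype.card u : ℝ) = n + 1 := by
    rw [b.card_eq_finrank_add_one]
    simp
  rw [b.convexHull_eq_nonneg_coord] at hpb
  set l : u → ℝ := fun i => (k + 1) * b.coord i p with hl
  have hl0 : ∀ i, 0 ≤ l i := fun i => mul_nonneg (by positivity) (hpb i)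
  have hlsum : ∑ i, l i = k + 1 := by
    rw [← Finset.mul_sum, b.sum_coord_apply_eq_one, mul_one]
  have hlx : ∑ i, l i • b i = x := by
    simp only [hl, mul_smul]
    rw [← Finset.smul_sum, b.linear_combination_coord_eq_self, ← hx, Nat.cast_add_one]
  by_cases h : ∃ j, 1 ≤ l j
  · obtain ⟨j, hj⟩ := h
    refine ⟨x - b j, ⟨?_, (latSubgroup n).sub_mem hxl (hbl j)⟩, b j, ⟨hbP j, hbl j⟩,
      sub_add_cancel _ _⟩
    have hxj : x - b j = ∑ i, (l i - if i = j then 1 else 0) • b i := by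
      simp [sub_smul, Finset.sum_sub_distrib, hlx]
    rw [hxj]
    refine sum_smul_mem_dilate hk0 hconv (fun i => ?_) ?_ hbP
    · split_ifs with hij
      · rw [hij]; linarith
      · simpa using hl0 i
    · simp [Finset.sum_sub_distrib, hlsum]
  · push Not at h
    exfalso
    obtain ⟨j⟩ := b.nonempty
    obtain ⟨c, hc⟩ : ∃ c : ℕ, r + k = n + c := ⟨r + k - n, by omega⟩
    have hc' : (r : ℝ) + k = n + c := by exact_mod_cast hc
    have hmem : ∑ i, (1 - l i + if i = j then (c : ℝ) else 0) • b i ∈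
        interior (dilate n r (convexHull ℝ (range b))) := by
      refine sum_smul_mem_interior_dilate hr1 b (fun i => ?_) ?_
      · have := h i
        have := c.cast_nonneg (α := ℝ)
        split_ifs <;> linarith
      · simp only [Finset.sum_add_distrib, Finset.sum_sub_distrib, hlsum, Finset.sum_const,
          Finset.card_univ, nsmul_eq_mul, hcard, Finset.sum_ite_eq', Finset.mem_univ, if_true]
        linarith
    have hlat : ∑ i, (1 - l i + if i = j then (c : ℝ) else 0) • b i ∈ latSubgroup n := by
      have heq : ∑ i, (1 - l i + if i = j then (c : ℝ) else 0) • b i =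
          ∑ i, b i - x + c • b j := by
        simp [add_smul, sub_smul, Finset.sum_add_distrib, Finset.sum_sub_distrib, hlx,
          Nat.cast_smul_eq_nsmul]
      rw [heq]
      exact add_mem (sub_mem (sum_mem fun i _ => hbl i) hxl) (nsmul_mem (hbl j) c)
    refine hempty.subset
      ⟨interior_mono (image_mono (convexHull_min ?_ hconv)) hmem, hlat⟩
    rintro _ ⟨i, rfl⟩
    exact hbP i
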